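/- arXiv:1603.06226 — 3 statements merged into one kernel-verified Lean document; each statement's English description precedes it below -/
import Mathlib

section
/- If a bipartite graph G=(L,R;E) is identifiable, then no vertex of L is isolated and G has a matching that saturates L (i.e., a matching of cardinality |L| matching every vertex of L to a vertex of R). -/
open Finset

/-- A (bipartitioned) bipartite graph on a finite ambient vertex type `V`:
two disjoint finite vertex sets `L` and `R`, and an adjacency relation
(oriented from `L` to `R`) all of whose edges join a vertex of `L`
to a vertex of `R`. -/
structure BipGraph (V : Type*) [DecidableEq V] [Fintype V] where
  L : Finset V
  R : Finset V
  disj : Disjoint L R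
  adj : V → V → Bool
  adj_mem : ∀ u v, adj u v = true → u ∈ L ∧ v ∈ R

namespace BipGraph

variable {V : Type*} [DecidableEq V] [Fintype V]

/-- `N(X)`: the set of vertices of `R` having a neighbor in `X`. -/
def nbhd (G : BipGraph V) (X : Finset V) : Finset V :=
  G.R.filter (fun r => ∃ x ∈ X, G.adj x r = true)

/-- A matching of `A` into `S`: an injective assignment matching every vertex
of `A` to an adjacent vertex of `S`. -/
def HasMatchingInto (G : BipGraph V) (A S : Finset V) : Prop :=
  ∃ f : V → V, Set.InjOn f ↑A ∧ ∀ a ∈ A, f a ∈ S ∧ G.adj a (f a) = true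

/-- `G = (L,R;E)` is identifiable if `E ≠ ∅` and for every `v ∈ L` there is a
matching (necessarily of cardinality `|L| - 1`) of `L \ {v}` into `R \ N(v)`. -/
def Identifiable (G : BipGraph V) : Prop :=
  (∃ u v, G.adj u v = true) ∧
    ∀ v ∈ G.L, G.HasMatchingInto (G.L.erase v) (G.R \ G.nbhd {v})

/-- The ℓ-subgraph of `G` induced by `J ⊆ L`: the induced subgraph
`G[J, R \ N(L \ J)]`. -/
def lSub (G : BipGraph V) (J : Finset V) : BipGraph V where
  L := J ∩ G.L
  R := G.R \ G.nbhd (G.L \ J)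
  disj := G.disj.mono inter_subset_right sdiff_subset
  adj := fun u v =>
    decide (u ∈ J ∩ G.L) && decide (v ∈ G.R \ G.nbhd (G.L \ J)) && G.adj u v
  adj_mem := by
    intro u v h
    simp only [Bool.and_eq_true, decide_eq_true_eq] at h
    exact ⟨h.1.1, h.1.2⟩

end BipGraph

/-- If a bipartite graph `G = (L,R;E)` is identifiable, then no vertex of `L` is
isolated and `G` has a matching that saturates `L`. -/
theorem stmt0 {V : Type*} [DecidableEq V] [Fintype V] (G : BipGraph V)
    (h : G.Identifiable) :
    (∀ v ∈ G.L, ∃ r, G.adj v r = true) ∧ G.HasMatchingInto G.L G.R := by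
  obtain ⟨⟨u, r, hur⟩, hM⟩ := h
  obtain ⟨huL, hrR⟩ := G.adj_mem u r hur
  obtain ⟨f, hf_inj, hf⟩ := hM u huL
  have f_ne : ∀ a ∈ G.L, a ≠ u → f a ≠ r := by
    rintro a ha hau rfl
    have hmem := (hf a (mem_erase.2 ⟨hau, ha⟩)).1
    simp [BipGraph.nbhd, hur] at hmem
  refine ⟨fun v hv => ?_, Function.update f u r, fun a ha b hb hab => ?_, fun a ha => ?_⟩
  · by_cases hvu : v = u
    · exact ⟨r, hvu ▸ hur⟩
    · exact ⟨f v, (hf v (mem_erase.2 ⟨hvu, hv⟩)).2⟩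
  · by_cases hau : a = u <;> by_cases hbu : b = u
    · rw [hau, hbu]
    · subst hau
      rw [Function.update_self, Function.update_of_ne hbu] at hab
      exact (f_ne b hb hbu hab.symm).elim
    · subst hbu
      rw [Function.update_self, Function.update_of_ne hau] at hab
      exact (f_ne a ha hau hab).elim
    · rw [Function.update_of_ne hau, Function.update_of_ne hbu] at hab
      exact hf_inj (mem_erase.2 ⟨hau, ha⟩) (mem_erase.2 ⟨hbu, hb⟩) hab
  · by_cases hau : a = u
    · subst hau
      rw [Function.update_self]
      exact ⟨hrR, hur⟩
    · rw [Function.update_of_ne hau]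
      have hfa := hf a (mem_erase.2 ⟨hau, ha⟩)
      exact ⟨(mem_sdiff.1 hfa.1).1, hfa.2⟩
end

section
/- Let G=(L,R;E) be a bipartite graph with at least one edge that is not identifiable, let v∈L be such that there is no matching of L\{v} into R\N(v), and let K be an inclusion-wise minimal subset of L\{v} that has no matching into R\N(v). Then for every J⊆L such that the ℓ-subgraph G(J) is identifiable, J∩K=∅; that is, no identifiable ℓ-subgraph of G contains a vertex of K. -/
open Finset

namespace BipGraph

variable {V : Type*} [DecidableEq V] [Fintype V]

/-- `K` is an inclusion-wise minimal subset of `L \ {v}` having no matching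
into `R \ N(v)`. -/
def MinNonMatchable (G : BipGraph V) (v : V) (K : Finset V) : Prop :=
  K ⊆ G.L.erase v ∧ ¬ G.HasMatchingInto K (G.R \ G.nbhd {v}) ∧
    ∀ K' ⊂ K, G.HasMatchingInto K' (G.R \ G.nbhd {v})

end BipGraph

namespace BipGraph

/-- In an identifiable graph, all of `L` can be matched into `R`: extend the matching avoiding
the neighborhood of a non-isolated `u` by an edge at `u`. -/
theorem Identifiable.hasMatchingInto {V : Type*} [DecidableEq V] [Fintype V] {G : BipGraph V}
    (h : G.Identifiable) : G.HasMatchingInto G.L G.R := by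
  obtain ⟨⟨u, w, huw⟩, h⟩ := h
  obtain ⟨hu, hw⟩ := G.adj_mem u w huw
  obtain ⟨f, hf, hadj⟩ := h u hu
  have hne : ∀ a ∈ G.L, a ≠ u → f a ≠ w := by
    rintro a ha hau rfl
    have := (hadj a (mem_erase.2 ⟨hau, ha⟩)).1
    simp [nbhd, huw] at this
  refine ⟨Function.update f u w, ?_, fun a ha => ?_⟩
  · intro a ha b hb hab
    by_cases hau : a = u <;> by_cases hbu : b = u
    · exact hau.trans hbu.symm
    · subst hau
      simp only [Function.update_self, Function.update_of_ne hbu] at hab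
      exact absurd hab.symm (hne b hb hbu)
    · subst hbu
      simp only [Function.update_self, Function.update_of_ne hau] at hab
      exact absurd hab (hne a ha hau)
    · simp only [Function.update_of_ne hau, Function.update_of_ne hbu] at hab
      exact hf (mem_erase.2 ⟨hau, ha⟩) (mem_erase.2 ⟨hbu, hb⟩) hab
  · by_cases hau : a = u
    · subst hau
      simpa using ⟨hw, huw⟩
    · rw [Function.update_of_ne hau]
      obtain ⟨h₁, h₂⟩ := hadj a (mem_erase.2 ⟨hau, ha⟩)
      exact ⟨(mem_sdiff.1 h₁).1, h₂⟩

/-- If `G(J)` is identifiable, then `J \ {v}` has a matching into the vertices of `R`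
adjacent neither to `v` nor to `L \ J`. -/
theorem hasMatchingInto_of_identifiable_lSub {V : Type*} [DecidableEq V] [Fintype V]
    {G : BipGraph V} {J : Finset V} (hJ : J ⊆ G.L) (h : (G.lSub J).Identifiable)
    {v : V} (hv : v ∈ G.L) :
    G.HasMatchingInto (J.erase v) ((G.R \ G.nbhd {v}) \ G.nbhd (G.L \ J)) := by
  by_cases hvJ : v ∈ J
  · obtain ⟨f, hf, hadj⟩ := h.2 v (mem_inter.2 ⟨hvJ, hv⟩)
    have hL : (G.lSub J).L = J := inter_eq_left.2 hJ
    rw [hL] at hf hadj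
    refine ⟨f, hf, fun a ha => ?_⟩
    obtain ⟨h₁, h₂⟩ := hadj a ha
    simp only [lSub, nbhd, mem_sdiff, mem_filter, mem_singleton, exists_eq_left,
      Bool.and_eq_true, decide_eq_true_eq, mem_inter] at h₁ h₂ ⊢
    refine ⟨⟨⟨h₁.1.1, fun hn => h₁.2 ⟨h₁.1, ⟨⟨hvJ, hv⟩, h₁.1⟩, hn.2⟩⟩, h₁.1.2⟩, h₂.2⟩
  · obtain ⟨f, hf, hadj⟩ := h.hasMatchingInto
    have hL : (G.lSub J).L = J := inter_eq_left.2 hJ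
    rw [hL] at hf hadj
    rw [erase_eq_of_notMem hvJ]
    refine ⟨f, hf, fun a ha => ?_⟩
    obtain ⟨h₁, h₂⟩ := hadj a ha
    have hR := mem_sdiff.1 h₁
    simp only [lSub, Bool.and_eq_true] at h₂
    refine ⟨mem_sdiff.2 ⟨mem_sdiff.2 ⟨hR.1, fun hn => hR.2 ?_⟩, hR.2⟩, h₂.2⟩
    simp only [nbhd, mem_filter, mem_singleton, exists_eq_left] at hn ⊢
    exact ⟨hn.1, v, mem_sdiff.2 ⟨hv, hvJ⟩, hn.2⟩

/-- A matching of `A` whose values avoid the neighborhood of a set containing `K \ A` can be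
glued with a matching of `K \ A`. -/
theorem HasMatchingInto.glue {V : Type*} [DecidableEq V] [Fintype V]
    {G : BipGraph V} {A B K S : Finset V} (hA : G.HasMatchingInto A (S \ G.nbhd B))
    (hKB : K \ A ⊆ B) (hK : G.HasMatchingInto (K \ A) S) : G.HasMatchingInto K S := by
  obtain ⟨f, hf, hfadj⟩ := hA
  obtain ⟨g, hg, hgadj⟩ := hK
  have hne : ∀ a ∈ A, ∀ b ∈ K, b ∉ A → f a ≠ g b := by
    intro a ha b hb hbA hab
    have hbKA := mem_sdiff.2 ⟨hb, hbA⟩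
    have hgb := (hgadj b hbKA).2
    refine (mem_sdiff.1 (hfadj a ha).1).2 ?_
    rw [hab]
    exact mem_filter.2 ⟨(G.adj_mem _ _ hgb).2, b, hKB hbKA, hgb⟩
  refine ⟨fun x => if x ∈ A then f x else g x, ?_, fun a ha => ?_⟩
  · intro a ha b hb hab
    by_cases haA : a ∈ A <;> by_cases hbA : b ∈ A <;> simp only [haA, hbA, if_true, if_false] at hab
    · exact hf haA hbA hab
    · exact absurd hab (hne a haA b hb hbA)
    · exact absurd hab.symm (hne b hbA a ha haA)
    · exact hg (mem_sdiff.2 ⟨ha, haA⟩) (mem_sdiff.2 ⟨hb, hbA⟩) hab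
  · by_cases haA : a ∈ A
    · simp only [haA, if_true]
      exact ⟨(mem_sdiff.1 (hfadj a haA).1).1, (hfadj a haA).2⟩
    · simp only [haA, if_false]
      exact hgadj a (mem_sdiff.2 ⟨ha, haA⟩)

end BipGraph

/-- Lemma 1 of the paper: if `G` is a non-identifiable bipartite graph with at
least one edge, `v ∈ L` has no matching of `L \ {v}` into `R \ N(v)`, and `K` is
an inclusion-wise minimal subset of `L \ {v}` with no matching into `R \ N(v)`,
then no identifiable ℓ-subgraph of `G` contains a vertex of `K`. -/
theorem stmt2 {V : Type*} [DecidableEq V] [Fintype V] (G : BipGraph V)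
    (hE : ∃ u w, G.adj u w = true) (hni : ¬ G.Identifiable)
    (v : V) (hv : v ∈ G.L)
    (hnm : ¬ G.HasMatchingInto (G.L.erase v) (G.R \ G.nbhd {v}))
    (K : Finset V) (hK : G.MinNonMatchable v K) :
    ∀ J ⊆ G.L, (G.lSub J).Identifiable → J ∩ K = ∅ := by
  intro J hJ hid
  obtain ⟨hKL, hKnm, hmin⟩ := hK
  by_contra hne
  obtain ⟨x, hx⟩ := nonempty_iff_ne_empty.2 hne
  obtain ⟨hxJ, hxK⟩ := mem_inter.1 hx
  have hxv : x ∈ J.erase v := mem_erase.2 ⟨(mem_erase.1 (hKL hxK)).1, hxJ⟩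
  refine hKnm ((BipGraph.hasMatchingInto_of_identifiable_lSub hJ hid hv).glue ?_ (hmin _ ?_))
  · intro y hy
    obtain ⟨hyK, hyJ⟩ := mem_sdiff.1 hy
    obtain ⟨hyv, hyL⟩ := mem_erase.1 (hKL hyK)
    exact mem_sdiff.2 ⟨hyL, fun h => hyJ (mem_erase.2 ⟨hyv, h⟩)⟩
  · exact (ssubset_iff_of_subset sdiff_subset).2 ⟨x, hxK, fun h => (mem_sdiff.1 h).2 hxv⟩
end

section
/- If G=(L,R;E) is a bipartite graph with at least one edge that is not identifiable, then there exists a nonempty subset K⊆L such that no identifiable ℓ-subgraph of G contains a vertex of K (i.e., every J⊆L for which the ℓ-subgraph G(J) is identifiable satisfies J∩K=∅). -/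
open Finset

namespace BipGraph

variable {V : Type*} [DecidableEq V] [Fintype V] {G : BipGraph V}

/-- `A` can be matched into the set of vertices all of whose neighbors lie in `A`. -/
def ClosedMatchable (G : BipGraph V) (A : Finset V) : Prop :=
  ∃ f : V → V, Set.InjOn f ↑A ∧
    ∀ a ∈ A, G.adj a (f a) = true ∧ ∀ u, G.adj u (f a) = true → u ∈ A

theorem ClosedMatchable.empty : G.ClosedMatchable ∅ :=
  ⟨id, by simp, by simp⟩

theorem ClosedMatchable.union {A B : Finset V} (hA : G.ClosedMatchable A)
    (hB : G.ClosedMatchable B) : G.ClosedMatchable (A ∪ B) := by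
  obtain ⟨f, hf, hfA⟩ := hA
  obtain ⟨g, hg, hgB⟩ := hB
  refine ⟨fun x => if x ∈ A then f x else g x, ?_, ?_⟩
  · intro x hx y hy hxy
    simp only [coe_union, Set.mem_union, mem_coe] at hx hy
    by_cases hxA : x ∈ A <;> by_cases hyA : y ∈ A <;> simp only [hxA, hyA, if_true, if_false] at hxy
    · exact hf hxA hyA hxy
    · exact absurd ((hfA x hxA).2 y (hxy ▸ (hgB y (hy.resolve_left hyA)).1)) hyA
    · exact absurd ((hfA y hyA).2 x (hxy ▸ (hgB x (hx.resolve_left hxA)).1)) hxA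
    · exact hg (hx.resolve_left hxA) (hy.resolve_left hyA) hxy
  · intro a ha
    by_cases haA : a ∈ A
    · simp only [haA, if_true]
      exact ⟨(hfA a haA).1, fun u hu => mem_union_left _ ((hfA a haA).2 u hu)⟩
    · simp only [haA, if_false]
      have haB := hgB a ((mem_union.1 ha).resolve_left haA)
      exact ⟨haB.1, fun u hu => mem_union_right _ (haB.2 u hu)⟩

theorem ClosedMatchable.biUnion {ι : Type*} {s : Finset ι} {A : ι → Finset V}
    (h : ∀ i ∈ s, G.ClosedMatchable (A i)) : G.ClosedMatchable (s.biUnion A) := by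
  classical
  induction s using Finset.induction_on with
  | empty => exact ClosedMatchable.empty
  | insert i s _ ih =>
    rw [biUnion_insert]
    exact (h i (mem_insert_self i s)).union (ih fun j hj => h j (mem_insert_of_mem hj))

theorem ClosedMatchable.insert {A : Finset V} {u w : V} (hA : G.ClosedMatchable A)
    (huA : u ∉ A) (huw : G.adj u w = true)
    (hw : ∀ x, G.adj x w = true → x ∈ Insert.insert u A) :
    G.ClosedMatchable (Insert.insert u A) := by
  obtain ⟨f, hf, hfA⟩ := hA
  have hne : ∀ a ∈ A, f a ≠ w := fun a ha h => huA ((hfA a ha).2 u (h ▸ huw))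
  refine ⟨Function.update f u w, ?_, ?_⟩
  · rw [coe_insert, Set.injOn_insert (mod_cast huA)]
    have hEq : Set.EqOn f (Function.update f u w) ↑A := fun a ha =>
      (Function.update_of_ne (by rintro rfl; exact huA ha) _ _).symm
    refine ⟨hf.congr hEq, ?_⟩
    rintro ⟨a, ha, h⟩
    rw [← hEq ha, Function.update_self] at h
    exact hne a ha h
  · intro a ha
    rcases mem_insert.1 ha with rfl | haA
    · simpa using ⟨huw, fun x hx => mem_insert.1 (hw x hx)⟩
    · rw [Function.update_of_ne (by rintro rfl; exact huA haA)]
      exact ⟨(hfA a haA).1, fun x hx => mem_insert_of_mem ((hfA a haA).2 x hx)⟩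

theorem lSub_adj_iff {J : Finset V} (hJ : J ⊆ G.L) {u w : V} :
    (G.lSub J).adj u w = true ↔ G.adj u w = true ∧ ∀ x, G.adj x w = true → x ∈ J := by
  simp only [lSub, nbhd, Bool.and_eq_true, decide_eq_true_eq, mem_inter, mem_sdiff, mem_filter,
    not_and, not_exists]
  constructor
  · rintro ⟨⟨_, hw, h⟩, huw⟩
    refine ⟨huw, fun x hx => ?_⟩
    by_contra hxJ
    exact h hw x ⟨(G.adj_mem _ _ hx).1, hxJ⟩ hx
  · rintro ⟨huw, h⟩
    exact ⟨⟨⟨h u huw, hJ (h u huw)⟩, (G.adj_mem _ _ huw).2, fun _ x hx hxw => hx.2 (h x hxw)⟩, huw⟩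

theorem closedMatchable_erase_of_identifiable {J : Finset V} (hJ : J ⊆ G.L)
    (h : (G.lSub J).Identifiable) (v : V) : G.ClosedMatchable (J.erase v) := by
  have hL : (G.lSub J).L = J := inter_eq_left.2 hJ
  have key : ∀ v ∈ J, G.ClosedMatchable (J.erase v) := by
    intro v hv
    obtain ⟨f, hf, hfJ⟩ := h.2 v (hL.symm ▸ hv)
    rw [hL] at hf hfJ
    refine ⟨f, hf, fun a ha => ?_⟩
    obtain ⟨hR, hadj⟩ := hfJ a ha
    obtain ⟨haf, hclosed⟩ := (lSub_adj_iff hJ).1 hadj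
    refine ⟨haf, fun u hu => mem_erase.2 ⟨?_, hclosed u hu⟩⟩
    rintro rfl
    exact (mem_sdiff.1 hR).2 (mem_filter.2 ⟨(mem_sdiff.1 hR).1, u, mem_singleton_self u,
      (lSub_adj_iff hJ).2 ⟨hu, hclosed⟩⟩)
  by_cases hv : v ∈ J
  · exact key v hv
  · obtain ⟨u, w, huw⟩ := h.1
    obtain ⟨huw, hw⟩ := (lSub_adj_iff hJ).1 huw
    have hins := insert_erase (hw u huw)
    rw [erase_eq_of_notMem hv, ← hins]
    exact (key u (hw u huw)).insert (notMem_erase u J) huw (hins.symm ▸ hw)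

theorem identifiable_of_closedMatchable (G : BipGraph V) (hE : ∃ u w, G.adj u w = true)
    (h : ∀ v ∈ G.L, G.ClosedMatchable (G.L.erase v)) : G.Identifiable := by
  refine ⟨hE, fun v hv => ?_⟩
  obtain ⟨f, hf, hfL⟩ := h v hv
  refine ⟨f, hf, fun a ha => ⟨mem_sdiff.2 ⟨(G.adj_mem _ _ (hfL a ha).1).2, fun hn => ?_⟩,
    (hfL a ha).1⟩⟩
  obtain ⟨-, x, hx, hxa⟩ := mem_filter.1 hn
  rw [mem_singleton] at hx
  subst hx
  exact notMem_erase x G.L ((hfL a ha).2 x hxa)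

end BipGraph

/-- If `G = (L,R;E)` is a bipartite graph with at least one edge that is not
identifiable, then there exists a nonempty subset `K ⊆ L` such that no
identifiable ℓ-subgraph of `G` contains a vertex of `K`. -/
theorem stmt3 {V : Type*} [DecidableEq V] [Fintype V] (G : BipGraph V)
    (hE : ∃ u w, G.adj u w = true) (hni : ¬ G.Identifiable) :
    ∃ K ⊆ G.L, K.Nonempty ∧
      ∀ J ⊆ G.L, (G.lSub J).Identifiable → J ∩ K = ∅ := by
  classical
  refine ⟨G.L.filter (fun x => ∀ J ⊆ G.L, (G.lSub J).Identifiable → x ∉ J),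
    filter_subset _ _, ?_, ?_⟩
  · by_contra hK
    rw [not_nonempty_iff_eq_empty, filter_eq_empty_iff] at hK
    push Not at hK
    replace hK : ∀ x ∈ G.L, ∃ J ⊆ G.L, (G.lSub J).Identifiable ∧ x ∈ J := fun x hx => hK hx
    choose! J hJL hJ hxJ using hK
    refine hni (G.identifiable_of_closedMatchable hE fun v _ => ?_)
    have hcover : G.L.erase v = G.L.biUnion (fun x => (J x).erase v) := by
      ext y
      simp only [mem_erase, mem_biUnion]
      exact ⟨fun ⟨hyv, hy⟩ => ⟨y, hy, hyv, hxJ y hy⟩,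
        fun ⟨x, hx, hyv, hy⟩ => ⟨hyv, hJL x hx hy⟩⟩
    rw [hcover]
    exact BipGraph.ClosedMatchable.biUnion fun x hx =>
      BipGraph.closedMatchable_erase_of_identifiable (hJL x hx) (hJ x hx) v
  · intro J hJL hJ
    ext x
    simp only [mem_inter, mem_filter, notMem_empty, iff_false]
    exact fun ⟨hx, _, hx'⟩ => hx' J hJL hJ hx
end
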